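/- Let K be a field, S = K[x_1,…,x_n], let J ⊆ I be squarefree monomial ideals of S, and suppose u = x_1⋯x_k lies in I \ J and every squarefree monomial of degree k+1 that is a multiple of u lies in J. Then the annihilator in S of the class of u in I/J is the prime ideal (x_{k+1},…,x_n); in particular (x_{k+1},…,x_n) is an associated prime of the S-module I/J. -/

import Mathlib

open MvPolynomial

/-- The squarefree monomial with support `T` in `K[x_0,…,x_{n-1}]`. -/
noncomputable def sqf (K : Type*) [Field K] (n : ℕ) (T : Finset (Fin n)) :
    MvPolynomial (Fin n) K :=
  ∏ i ∈ T, X i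

/-- The poset `P_{I\J}`: supports of squarefree monomials lying in `I \ J`. -/
def sqfPoset (K : Type*) [Field K] (n : ℕ) (I J : Ideal (MvPolynomial (Fin n) K)) :
    Set (Finset (Fin n)) :=
  {T | sqf K n T ∈ I ∧ sqf K n T ∉ J}

/-- Supports of squarefree monomials of degree `d` lying in `I \ J`. -/
def degSet (K : Type*) [Field K] (n : ℕ) (I J : Ideal (MvPolynomial (Fin n) K)) (d : ℕ) :
    Set (Finset (Fin n)) :=
  {T | T.card = d ∧ T ∈ sqfPoset K n I J}

/-- A partition of a set `P` of supports of squarefree monomials into intervals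
`[u,v] = {w : u ⊆ w ⊆ v}`. -/
structure SqfPartition (n : ℕ) (P : Set (Finset (Fin n))) where
  intervals : Finset (Finset (Fin n) × Finset (Fin n))
  le : ∀ p ∈ intervals, p.1 ⊆ p.2
  ends : ∀ p ∈ intervals, p.1 ∈ P ∧ p.2 ∈ P
  covers : ∀ T ∈ P, ∃ p ∈ intervals, p.1 ⊆ T ∧ T ⊆ p.2
  disj : ∀ p ∈ intervals, ∀ q ∈ intervals, ∀ T : Finset (Fin n),
    p.1 ⊆ T → T ⊆ p.2 → q.1 ⊆ T → T ⊆ q.2 → p = q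

/-- The Stanley depth of a partition: the minimal degree of the upper ends of
its intervals. -/
noncomputable def SqfPartition.sdepth {n : ℕ} {P : Set (Finset (Fin n))}
    (pt : SqfPartition n P) : ℕ :=
  sInf {k | ∃ p ∈ pt.intervals, p.2.card = k}

/-- The Stanley depth of `I/J`: the maximal Stanley depth of a partition of `P_{I\J}`. -/
noncomputable def stanleyDepth (K : Type*) [Field K] (n : ℕ)
    (I J : Ideal (MvPolynomial (Fin n) K)) : ℕ :=
  sSup {k | ∃ pt : SqfPartition n (sqfPoset K n I J), pt.sdepth = k}

/-- The `S`-module `I/J` (for `J ⊆ I` this is the usual quotient). -/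
noncomputable abbrev quotMod (K : Type*) [Field K] (n : ℕ)
    (I J : Ideal (MvPolynomial (Fin n) K)) : Type _ :=
  I ⧸ (Submodule.comap I.subtype J)

/-- The depth of `I/J` over `S = K[x_0,…,x_{n-1}]`: the supremum of lengths of
regular sequences on `I/J` consisting of elements of the maximal graded ideal
`(x_0,…,x_{n-1})`. -/
noncomputable def mdepth (K : Type*) [Field K] (n : ℕ)
    (I J : Ideal (MvPolynomial (Fin n) K)) : ℕ :=
  sSup {k | ∃ rs : List (MvPolynomial (Fin n) K), rs.length = k ∧
    (∀ r ∈ rs, r ∈ Ideal.span (Set.range (X : Fin n → MvPolynomial (Fin n) K))) ∧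
    RingTheory.Sequence.IsRegular (quotMod K n I J) rs}

theorem isPrime_span_X_image {σ R : Type*} [CommRing R] [IsDomain R] (s : Set σ) :
    (Ideal.span ((X : σ → MvPolynomial σ R) '' s)).IsPrime := by
  classical
  set P := Ideal.span ((X : σ → MvPolynomial σ R) '' s) with hP
  let φ : MvPolynomial σ R →ₐ[R] MvPolynomial σ R := aeval fun i => if i ∈ s then 0 else X i
  have hcomp : (Ideal.Quotient.mkₐ R P).comp φ = Ideal.Quotient.mkₐ R P := by
    ext i
    by_cases hi : i ∈ s
    · have hX : Ideal.Quotient.mk P (X i) = 0 :=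
        Ideal.Quotient.eq_zero_iff_mem.2 (Ideal.subset_span ⟨i, hi, rfl⟩)
      simp [φ, hi, hX]
    · simp [φ, hi]
  have hker : P = RingHom.ker φ := by
    refine le_antisymm (Ideal.span_le.2 ?_) fun p hp => ?_
    · rintro _ ⟨i, hi, rfl⟩
      simp [φ, RingHom.mem_ker, hi]
    · have h := DFunLike.congr_fun hcomp p
      rw [AlgHom.comp_apply, (RingHom.mem_ker).1 hp, map_zero] at h
      exact Ideal.Quotient.eq_zero_iff_mem.1 h.symm
  rw [hker]
  exact RingHom.ker_isPrime φ

section Squarefree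

variable {K : Type*} [Field K] {n : ℕ}

theorem sqf_eq_monomial (T : Finset (Fin n)) :
    sqf K n T = monomial (∑ i ∈ T, Finsupp.single i 1) 1 := by
  simp [sqf, X, monomial_sum_one]

theorem sum_single_one_apply (T : Finset (Fin n)) (i : Fin n) :
    (∑ j ∈ T, Finsupp.single j 1 : Fin n →₀ ℕ) i = if i ∈ T then 1 else 0 := by
  simp [Finsupp.finsetSum_apply, Finsupp.single_apply]

theorem sqf_dvd_sqf {T U : Finset (Fin n)} (h : T ⊆ U) : sqf K n T ∣ sqf K n U :=
  Finset.prod_dvd_prod_of_subset _ _ _ h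

theorem X_mul_sqf {T : Finset (Fin n)} {i : Fin n} (hi : i ∉ T) :
    X i * sqf K n T = sqf K n (insert i T) :=
  (Finset.prod_insert hi).symm

theorem mem_span_sqf_image {G : Set (Finset (Fin n))} {p : MvPolynomial (Fin n) K} :
    p ∈ Ideal.span (sqf K n '' G) ↔ ∀ m ∈ p.support, ∃ T ∈ G, ∀ i ∈ T, m i ≠ 0 := by
  have himage : sqf K n '' G = (fun m => monomial m (1 : K)) ''
      ((fun T : Finset (Fin n) => ∑ i ∈ T, Finsupp.single i 1) '' G) := by
    rw [Set.image_image]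
    exact Set.image_congr fun T _ => sqf_eq_monomial T
  rw [himage, mem_ideal_span_monomial_image]
  refine forall₂_congr fun m _ => ?_
  rw [Set.exists_mem_image]
  refine exists_congr fun T => and_congr_right fun _ => ?_
  rw [Finsupp.le_def]
  refine forall_congr' fun i => ?_
  rw [sum_single_one_apply]
  split_ifs with hi <;> simp [hi, Nat.one_le_iff_ne_zero]

/-- If a squarefree monomial lies outside a squarefree monomial ideal `J`, but all its products
with further variables lie in `J`, then the colon ideal is generated by those variables. -/
theorem mul_sqf_mem_iff {J : Ideal (MvPolynomial (Fin n) K)}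
    (hJ : ∃ G : Set (Finset (Fin n)), J = Ideal.span (sqf K n '' G)) {U : Finset (Fin n)}
    (hU : sqf K n U ∉ J) (hins : ∀ i ∉ U, sqf K n (insert i U) ∈ J)
    {p : MvPolynomial (Fin n) K} :
    p * sqf K n U ∈ J ↔ p ∈ Ideal.span (X '' {i : Fin n | i ∉ U}) := by
  constructor
  · obtain ⟨G, rfl⟩ := hJ
    intro hp
    rw [mem_ideal_span_X_image]
    intro m hm
    by_contra! hm0
    rw [mem_span_sqf_image] at hp
    obtain ⟨T, hTG, hT⟩ := hp (m + ∑ i ∈ U, Finsupp.single i 1) (by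
      rw [mem_support_iff, sqf_eq_monomial, coeff_mul_monomial, mul_one]
      exact mem_support_iff.1 hm)
    refine hU (Ideal.mem_of_dvd _ (sqf_dvd_sqf fun i hi => ?_)
      (Ideal.subset_span ⟨T, hTG, rfl⟩))
    by_contra hiU
    refine hT i hi ?_
    rw [Finsupp.add_apply, sum_single_one_apply, if_neg hiU, hm0 i hiU]
  · intro hp
    have hle : Ideal.span (X '' {i : Fin n | i ∉ U}) ≤ J.colon {sqf K n U} := by
      refine Ideal.span_le.2 ?_
      rintro _ ⟨i, hi, rfl⟩
      rw [SetLike.mem_coe, Submodule.mem_colon_singleton, smul_eq_mul, X_mul_sqf hi]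
      exact hins i hi
    exact Submodule.mem_colon_singleton.1 (hle hp)

end Squarefree

/-- The annihilator of the class of `u = x_1 ⋯ x_k` in `I/J`
(proof of **Lemma 1.5**). -/
theorem stmt8 (n : ℕ) (K : Type*) [Field K]
    (I J : Ideal (MvPolynomial (Fin n) K))
    (hI : ∃ G : Set (Finset (Fin n)), I = Ideal.span (sqf K n '' G))
    (hJ : ∃ G : Set (Finset (Fin n)), J = Ideal.span (sqf K n '' G))
    (hJI : J ≤ I)
    (k : ℕ) (hk : k ≤ n)
    (U : Finset (Fin n)) (hU : U = Finset.univ.filter (fun i : Fin n => (i : ℕ) < k))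
    (hUI : sqf K n U ∈ I) (hUJ : sqf K n U ∉ J)
    (hmult : ∀ T : Finset (Fin n), U ⊆ T → T.card = k + 1 → sqf K n T ∈ J) :
    (Submodule.span (MvPolynomial (Fin n) K)
        {(Submodule.Quotient.mk ⟨sqf K n U, hUI⟩ : quotMod K n I J)}).annihilator =
      Ideal.span (X '' {i : Fin n | k ≤ (i : ℕ)}) ∧
    IsAssociatedPrime (Ideal.span ((X : Fin n → MvPolynomial (Fin n) K) '' {i : Fin n | k ≤ (i : ℕ)}))
      (quotMod K n I J) := by
  have hcompl : {i : Fin n | k ≤ (i : ℕ)} = {i | i ∉ U} := by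
    ext i
    simp [hU]
  have hcard : U.card = k := by
    rw [hU, Fin.card_filter_val_lt, min_eq_right hk]
  have hins : ∀ i ∉ U, sqf K n (insert i U) ∈ J := fun i hi =>
    hmult _ (Finset.subset_insert i U) (by rw [Finset.card_insert_of_notMem hi, hcard])
  have hsmul : ∀ p : MvPolynomial (Fin n) K,
      p • (Submodule.Quotient.mk ⟨sqf K n U, hUI⟩ : quotMod K n I J) = 0 ↔
        p ∈ Ideal.span (X '' {i : Fin n | k ≤ (i : ℕ)}) := fun p => by
    rw [← Submodule.Quotient.mk_smul, Submodule.Quotient.mk_eq_zero, hcompl,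
      ← mul_sqf_mem_iff hJ hUJ hins]
    rfl
  have hprime := isPrime_span_X_image (R := K) {i : Fin n | k ≤ (i : ℕ)}
  refine ⟨?_, isAssociatedPrime_iff.2 ⟨hprime,
    (Submodule.Quotient.mk ⟨sqf K n U, hUI⟩ : quotMod K n I J), ?_⟩⟩
  · ext p
    rw [Submodule.mem_annihilator_span_singleton, hsmul]
  · ext p
    rw [Submodule.mem_colon_singleton, Submodule.mem_bot, hsmul]
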